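/- Let (X, d) be a nonempty compact metric space, M* = Con(X)^ℕ with metric D, and η the IFS right shift map. Let Per(η) = {F ∈ M* : η^n(F) = F for some n ≥ 1} be the set of periodic points of η. Then Per(η) is dense in (M*, D), i.e., the closure of Per(η) equals M*. -/

import Mathlib

/-- A map `f : X → X` is a contraction if there is `0 ≤ c < 1` with
`d(f x, f y) ≤ c * d(x, y)` for all `x, y`. -/
def IsContractionMap {X : Type*} [MetricSpace X] (f : X → X) : Prop :=
  ∃ c : ℝ, 0 ≤ c ∧ c < 1 ∧ ∀ x y, dist (f x) (f y) ≤ c * dist x y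

/-- `ConMaps X` is the set of all contraction self-maps of `X`. -/
def ConMaps (X : Type*) [MetricSpace X] := {f : X → X // IsContractionMap f}

/-- The sup metric `d_∞(f, g) = sup_{x ∈ X} d(f x, g x)` on `ConMaps X`. -/
noncomputable def dInfty {X : Type*} [MetricSpace X] (f g : ConMaps X) : ℝ :=
  ⨆ x : X, dist (f.1 x) (g.1 x)

/-- The bounded metric `d̄_∞ = d_∞ / (1 + d_∞)`. -/
noncomputable def dBar {X : Type*} [MetricSpace X] (f g : ConMaps X) : ℝ :=
  dInfty f g / (1 + dInfty f g)

/-- The metric `D(F, G) = Σ_{k=1}^∞ d̄_∞(f_k, g_k) / 2^k` on `M* = ConMaps(X)^ℕ`;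
sequences are indexed from `0`, so the `k`-th summand (`k = 0, 1, 2, …`) carries
weight `1 / 2^(k+1)`. -/
noncomputable def Dmet {X : Type*} [MetricSpace X] (F G : ℕ → ConMaps X) : ℝ :=
  ∑' k : ℕ, dBar (F k) (G k) / 2 ^ (k + 1)

/-- The IFS right shift map `η(f_1, f_2, f_3, …) = (f_2, f_3, f_4, …)`. -/
def shiftIFS {X : Type*} [MetricSpace X] (F : ℕ → ConMaps X) : ℕ → ConMaps X :=
  fun k => F (k + 1)

theorem dInfty_nonneg_aux {X : Type*} [MetricSpace X] (f g : ConMaps X) : 0 ≤ dInfty f g :=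
  Real.iSup_nonneg fun _ => dist_nonneg

theorem dBar_nonneg_aux {X : Type*} [MetricSpace X] (f g : ConMaps X) : 0 ≤ dBar f g := by
  have h := dInfty_nonneg_aux f g
  unfold dBar
  positivity

theorem dBar_le_one_aux {X : Type*} [MetricSpace X] (f g : ConMaps X) : dBar f g ≤ 1 := by
  have h := dInfty_nonneg_aux f g
  unfold dBar
  rw [div_le_one (by linarith)]
  linarith

theorem dBar_self_aux {X : Type*} [MetricSpace X] (f : ConMaps X) : dBar f f = 0 := by
  simp [dBar, dInfty]

theorem shiftIFS_iterate_aux {X : Type*} [MetricSpace X] (n : ℕ) (G : ℕ → ConMaps X) (k : ℕ) :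
    shiftIFS^[n] G k = G (k + n) := by
  induction n generalizing G with
  | zero => rfl
  | succ n ih =>
    rw [Function.iterate_succ_apply, ih]
    rfl

/-- The set of periodic points of the IFS right shift map `η` is dense in
`(M*, D)`: every `F ∈ M*` is within distance `ε` of some periodic point. -/
theorem periodic_points_dense {X : Type*} [MetricSpace X] [CompactSpace X] [Nonempty X]
    (F : ℕ → ConMaps X) (ε : ℝ) (hε : 0 < ε) :
    ∃ G : ℕ → ConMaps X, (∃ n : ℕ, 1 ≤ n ∧ shiftIFS^[n] G = G) ∧ Dmet F G < ε := by
  obtain ⟨m, hm⟩ := exists_pow_lt_of_lt_one hε (by norm_num : (1 / 2 : ℝ) < 1)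
  have hm' : (1 / 2 : ℝ) ^ (m + 1) < ε :=
    lt_of_le_of_lt (pow_le_pow_of_le_one (by norm_num) (by norm_num) (Nat.le_succ m)) hm
  refine ⟨fun k => F (k % (m + 1)), ⟨m + 1, by omega, ?_⟩, lt_of_le_of_lt ?_ hm'⟩
  · funext k
    rw [shiftIFS_iterate_aux]
    simp
  · have hb : ∀ k, dBar (F k) (F (k % (m + 1))) / 2 ^ (k + 1) ≤ (1 / 2 : ℝ) ^ (k + 1) := by
      intro k
      rw [one_div, inv_pow, ← one_div]
      gcongr
      exact dBar_le_one_aux _ _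
    have hn : ∀ k, 0 ≤ dBar (F k) (F (k % (m + 1))) / 2 ^ (k + 1) := fun k =>
      div_nonneg (dBar_nonneg_aux _ _) (by positivity)
    have hg : Summable fun k : ℕ => (1 / 2 : ℝ) ^ (k + 1) :=
      (summable_nat_add_iff 1).2 summable_geometric_two
    have hs := Summable.of_nonneg_of_le hn hb hg
    unfold Dmet
    rw [← hs.sum_add_tsum_nat_add (m + 1), Finset.sum_eq_zero, zero_add]
    · have h1 : ∑' k : ℕ, (1 / 2 : ℝ) ^ (k + (m + 1) + 1) = (1 / 2 : ℝ) ^ (m + 1) := by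
        have : ∀ k : ℕ, (1 / 2 : ℝ) ^ (k + (m + 1) + 1) = (1 / 2) ^ k * (1 / 2) ^ (m + 2) :=
          fun k => by ring
        simp_rw [this]
        rw [tsum_mul_right, tsum_geometric_two]
        ring
      rw [← h1]
      have hs2 := hs.comp_injective (add_left_injective (m + 1))
      have hg2 := hg.comp_injective (add_left_injective (m + 1))
      exact hs2.tsum_le_tsum (fun k => hb (k + (m + 1))) hg2
    · intro k hk
      rw [Nat.mod_eq_of_lt (Finset.mem_range.1 hk), dBar_self_aux, zero_div]
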